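/- Consider the dynamics x_{i+1} = A x_i + B u_i + w_i over the horizon i = 0,…,L−1, in stacked form x = Z𝒜x + Z𝓑u + δ with δ = (x_0; w_0; …; w_{L−1}). For any block-lower-triangular matrices (Φ_x, Φ_u) satisfying [I − Z𝒜, −Z𝓑][Φ_x; Φ_u] = I, the matrix Φ_x is invertible, the feedback K = Φ_u Φ_x^{−1} is block-lower-triangular, and the closed-loop system with u = Kx achieves the response (x; u) = [Φ_x; Φ_u](x_0; w_0; …; w_{L−1}) for every initial state x_0 and disturbance sequence w_0,…,w_{L−1}. -/

import Mathlib

open Matrix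

/-- The block matrix `Z𝒜`: `Z` is the block-downshift operator and
`𝒜 = blkdiag(A,…,A,O)` with `L` copies of `A`. -/
def ZA {nx : ℕ} (L : ℕ) (A : Matrix (Fin nx) (Fin nx) ℝ) :
    Matrix (Fin (L+1) × Fin nx) (Fin (L+1) × Fin nx) ℝ :=
  Matrix.of fun p q => if (p.1 : ℕ) = (q.1 : ℕ) + 1 then A p.2 q.2 else 0

/-- The block matrix `Z𝓑` with `𝓑 = blkdiag(B,…,B,O)` (`L` copies of `B`). -/
def ZB {nx nu : ℕ} (L : ℕ) (B : Matrix (Fin nx) (Fin nu) ℝ) :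
    Matrix (Fin (L+1) × Fin nx) (Fin (L+1) × Fin nu) ℝ :=
  Matrix.of fun p q => if (p.1 : ℕ) = (q.1 : ℕ) + 1 then B p.2 q.2 else 0

/-- A block-partitioned matrix is block-lower-triangular if all blocks strictly
above the block diagonal vanish. -/
def BlockLowerTri {n1 n2 a b : ℕ} (M : Matrix (Fin n1 × Fin a) (Fin n2 × Fin b) ℝ) : Prop :=
  ∀ p q, (p.1 : ℕ) < (q.1 : ℕ) → M p q = 0

/-- The stacked vector `δ = (x_0; w_0; …; w_{L−1})`. -/
def delta {nx : ℕ} (L : ℕ) (x0 : Fin nx → ℝ) (w : ℕ → Fin nx → ℝ) :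
    Fin (L+1) × Fin nx → ℝ :=
  fun p => if (p.1 : ℕ) = 0 then x0 p.2 else w ((p.1 : ℕ) - 1) p.2

theorem ZA_eq_ZB {nx : ℕ} (L : ℕ) (A : Matrix (Fin nx) (Fin nx) ℝ) : ZA L A = ZB L A := rfl

/-- A downshifted block-lower-triangular matrix is strictly block-lower-triangular. -/
theorem BlockLowerTri.ZB_mul_apply_eq_zero {nx nu k c L : ℕ} (B : Matrix (Fin nx) (Fin nu) ℝ)
    {M : Matrix (Fin (L+1) × Fin nu) (Fin k × Fin c) ℝ} (hM : BlockLowerTri M)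
    {p : Fin (L+1) × Fin nx} {q : Fin k × Fin c} (h : (p.1 : ℕ) ≤ q.1) :
    (ZB L B * M) p q = 0 := by
  rw [Matrix.mul_apply]
  refine Finset.sum_eq_zero fun r _ => ?_
  by_cases hr : (p.1 : ℕ) = r.1 + 1
  · rw [hM r q (by omega), mul_zero]
  · simp [ZB, hr]

theorem BlockLowerTri.mul {n1 n2 n a b c : ℕ}
    {M : Matrix (Fin n1 × Fin a) (Fin n2 × Fin b) ℝ}
    {N : Matrix (Fin n2 × Fin b) (Fin n × Fin c) ℝ}
    (hM : BlockLowerTri M) (hN : BlockLowerTri N) : BlockLowerTri (M * N) := by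
  intro p q hpq
  rw [Matrix.mul_apply]
  refine Finset.sum_eq_zero fun r _ => ?_
  rcases lt_or_ge (p.1 : ℕ) r.1 with h | h
  · rw [hM p r h, zero_mul]
  · rw [hN r q (by omega), mul_zero]

theorem blockLowerTri_iff_blockTriangular {n a : ℕ}
    {M : Matrix (Fin n × Fin a) (Fin n × Fin a) ℝ} :
    BlockLowerTri M ↔ M.BlockTriangular (fun p => OrderDual.toDual p.1) :=
  Iff.rfl

theorem BlockLowerTri.inv {n a : ℕ} {M : Matrix (Fin n × Fin a) (Fin n × Fin a) ℝ}
    (hM : BlockLowerTri M) (hu : IsUnit M) : BlockLowerTri M⁻¹ := by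
  rw [blockLowerTri_iff_blockTriangular] at hM ⊢
  have := hu.invertible
  exact Matrix.blockTriangular_inv_of_blockTriangular hM

/-- A block-lower-triangular matrix with identity diagonal blocks is invertible. -/
theorem BlockLowerTri.isUnit_of_diagonal_eq_one {n a : ℕ}
    {M : Matrix (Fin n × Fin a) (Fin n × Fin a) ℝ} (hM : BlockLowerTri M)
    (hdiag : ∀ p q, p.1 = q.1 → M p q = (1 : Matrix _ _ ℝ) p q) : IsUnit M := by
  rw [Matrix.isUnit_iff_isUnit_det, (blockLowerTri_iff_blockTriangular.1 hM).det]
  have hblock (k : (Fin n)ᵒᵈ) :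
      M.toSquareBlock (fun p => OrderDual.toDual p.1) k = 1 := by
    ext ⟨p, hp⟩ ⟨q, hq⟩
    have h : p.1 = q.1 := OrderDual.toDual.injective (hp.trans hq.symm)
    simp [Matrix.toSquareBlock_def, hdiag p q h, Matrix.one_apply]
  simp [hblock]

theorem ZB_mulVec_zero {nx nu L : ℕ} (B : Matrix (Fin nx) (Fin nu) ℝ)
    (v : Fin (L+1) × Fin nu → ℝ) (p : Fin (L+1) × Fin nx) (hp : (p.1 : ℕ) = 0) :
    (ZB L B *ᵥ v) p = 0 := by
  simp [Matrix.mulVec, dotProduct, ZB, hp]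

theorem ZB_mulVec_succ {nx nu L : ℕ} (B : Matrix (Fin nx) (Fin nu) ℝ) (v : ℕ → Fin nu → ℝ)
    (p : Fin (L+1) × Fin nx) {i : ℕ} (hp : (p.1 : ℕ) = i + 1) :
    (ZB L B *ᵥ fun q => v q.1 q.2) p = (B *ᵥ v i) p.2 := by
  have hi : i < L + 1 := by omega
  simp only [Matrix.mulVec, dotProduct, ZB, Matrix.of_apply, Fintype.sum_prod_type]
  rw [Finset.sum_eq_single (⟨i, hi⟩ : Fin (L+1))]
  · simp [hp]
  · intro j _ hj
    have : ¬ (i = (j : ℕ)) := fun h => hj (Fin.ext h.symm)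
    simp [hp, this]
  · simp

/-- The recursive dynamics in stacked form. -/
theorem stacked_dynamics {nx nu L : ℕ} (A : Matrix (Fin nx) (Fin nx) ℝ)
    (B : Matrix (Fin nx) (Fin nu) ℝ) (w x : ℕ → Fin nx → ℝ) (u : ℕ → Fin nu → ℝ)
    (h : ∀ i < L, x (i + 1) = A *ᵥ x i + B *ᵥ u i + w i) :
    (fun p : Fin (L+1) × Fin nx => x p.1 p.2) =
      ZA L A *ᵥ (fun p => x p.1 p.2) + ZB L B *ᵥ (fun p => u p.1 p.2) + delta L (x 0) w := by
  funext p
  rw [ZA_eq_ZB, Pi.add_apply, Pi.add_apply]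
  rcases hp : (p.1 : ℕ) with _ | i
  · simp [ZB_mulVec_zero _ _ p hp, delta, hp]
  · rw [ZB_mulVec_succ A x p hp, ZB_mulVec_succ B u p hp, h i (by omega)]
    simp [delta, hp]

/-- **SLS, converse direction** (Theorem 1, part 2): for any block-lower-triangular
`(Φx, Φu)` on the affine subspace `[I − Z𝒜, −Z𝓑][Φx; Φu] = I`, the matrix `Φx` is
invertible, the feedback `K = Φu Φx⁻¹` is block-lower-triangular, and the closed loop
`u = Kx` achieves the response `(x; u) = [Φx; Φu](x_0; w)` for every `x_0` and `w`. -/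
theorem sls_achieves_response
    (nx nu L : ℕ)
    (A : Matrix (Fin nx) (Fin nx) ℝ) (B : Matrix (Fin nx) (Fin nu) ℝ)
    (Φx : Matrix (Fin (L+1) × Fin nx) (Fin (L+1) × Fin nx) ℝ)
    (Φu : Matrix (Fin (L+1) × Fin nu) (Fin (L+1) × Fin nx) ℝ)
    (hΦx : BlockLowerTri Φx) (hΦu : BlockLowerTri Φu)
    (hconstr : (1 - ZA L A) * Φx - ZB L B * Φu = 1) :
    IsUnit Φx ∧ BlockLowerTri (Φu * Φx⁻¹) ∧
    ∀ (x0 : Fin nx → ℝ) (w : ℕ → Fin nx → ℝ)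
      (x : ℕ → Fin nx → ℝ) (u : ℕ → Fin nu → ℝ),
      x 0 = x0 →
      (∀ p : Fin (L+1) × Fin nu,
        u (p.1 : ℕ) p.2 = (Φu * Φx⁻¹).mulVec (fun q : Fin (L+1) × Fin nx => x (q.1 : ℕ) q.2) p) →
      (∀ i < L, x (i + 1) = A.mulVec (x i) + B.mulVec (u i) + w i) →
      (∀ p : Fin (L+1) × Fin nx, x (p.1 : ℕ) p.2 = Φx.mulVec (delta L x0 w) p) ∧
      (∀ p : Fin (L+1) × Fin nu, u (p.1 : ℕ) p.2 = Φu.mulVec (delta L x0 w) p) := by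
  have hdiag : ∀ p q, p.1 = q.1 → Φx p q = (1 : Matrix _ _ ℝ) p q := by
    intro p q h
    have hle : (p.1 : ℕ) ≤ q.1 := by rw [h]
    have hpq := congrFun (congrFun hconstr p) q
    rw [Matrix.sub_mul, Matrix.one_mul, ZA_eq_ZB, Matrix.sub_apply, Matrix.sub_apply,
      hΦx.ZB_mul_apply_eq_zero A hle, hΦu.ZB_mul_apply_eq_zero B hle, sub_zero, sub_zero] at hpq
    exact hpq
  have hunit : IsUnit Φx := hΦx.isUnit_of_diagonal_eq_one hdiag
  have hdet : IsUnit Φx.det := (Matrix.isUnit_iff_isUnit_det _).1 hunit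
  refine ⟨hunit, hΦu.mul (hΦx.inv hunit), ?_⟩
  rintro _ w x u rfl hu hdyn
  have hU : (fun p : Fin (L+1) × Fin nu => u p.1 p.2) =
      (Φu * Φx⁻¹) *ᵥ fun q : Fin (L+1) × Fin nx => x q.1 q.2 := funext hu
  have hstack := stacked_dynamics A B w x u hdyn
  have hinv : Φx⁻¹ = 1 - ZA L A - ZB L B * (Φu * Φx⁻¹) := by
    have := congrArg (· * Φx⁻¹) hconstr
    simp only [Matrix.sub_mul _ _ Φx⁻¹, Matrix.mul_assoc, Matrix.mul_nonsing_inv _ hdet,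
      Matrix.mul_one, Matrix.one_mul] at this
    exact this.symm
  have hδ : Φx⁻¹ *ᵥ (fun q : Fin (L+1) × Fin nx => x q.1 q.2) = delta L (x 0) w := by
    rw [hinv, Matrix.sub_mulVec, Matrix.sub_mulVec, Matrix.one_mulVec, ← Matrix.mulVec_mulVec,
      ← hU, sub_sub, sub_eq_iff_eq_add']
    exact hstack
  constructor
  · intro p
    rw [← hδ, Matrix.mulVec_mulVec, Matrix.mul_nonsing_inv _ hdet, Matrix.one_mulVec]
  · intro p
    rw [← hδ, Matrix.mulVec_mulVec]
    exact hu p
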